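/- Let E be a finite homogeneous effect algebra such that S(E) = {0, 1}. Then for every atom a of E there exists a natural number n such that n·a is well defined and a' = n·a. -/

import Mathlib

namespace EffectAlgebraPaper

/-- An effect algebra: a set with 0, 1 and a partially defined sum `add`,
whose domain is the relation `Orth` (written `a ⊥ b` in the paper). -/
class EffectAlgebra (E : Type*) where
  zero : E
  one : E
  /-- `Orth a b` means `a ⊕ b` is defined. -/
  Orth : E → E → Prop
  /-- The sum `a ⊕ b`, meaningful only when `Orth a b`. -/
  add : E → E → E
  orth_comm : ∀ a b : E, Orth a b → Orth b a
  add_comm : ∀ a b : E, Orth a b → add a b = add b a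
  assoc : ∀ a b c : E, Orth b c → Orth a (add b c) →
    Orth a b ∧ Orth (add a b) c ∧ add a (add b c) = add (add a b) c
  compl_exists : ∀ a : E, ∃! b : E, Orth a b ∧ add a b = one
  orth_one : ∀ a : E, Orth a one → a = zero

namespace EffectAlgebra

variable {E : Type*} [EffectAlgebra E]

/-- The orthosupplement `a'`. -/
noncomputable def compl (a : E) : E := (compl_exists a).exists.choose

/-- The effect-algebra partial order: `a ≤ b` iff `a ⊕ c = b` for some `c`. -/
def le (a b : E) : Prop := ∃ c : E, Orth a c ∧ add a c = b

/-- The interval `[x, y] = {z : x ≤ z ≤ y}`. -/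
def Interval (x y : E) : Set E := { z : E | le x z ∧ le z y }

/-- An atom: a minimal nonzero element. -/
def Atom (a : E) : Prop := a ≠ zero ∧ ∀ b : E, b ≠ zero → le b a → b = a

/-- A sharp element: the only common lower bound of `x` and `x'` is `0`. -/
def Sharp (x : E) : Prop := ∀ b : E, le b x → le b (compl x) → b = zero

/-- `S(E)`, the set of sharp elements. -/
def sharpSet (E : Type*) [EffectAlgebra E] : Set E := { x : E | Sharp x }

/-- Homogeneity: `u ≤ v₁ ⊕ v₂ ≤ u'` implies `u = u₁ ⊕ u₂` with `u₁ ≤ v₁`, `u₂ ≤ v₂`. -/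
def Homogeneous (E : Type*) [EffectAlgebra E] : Prop :=
  ∀ u v₁ v₂ : E, Orth v₁ v₂ → le u (add v₁ v₂) → le (add v₁ v₂) (compl u) →
    ∃ u₁ u₂ : E, le u₁ v₁ ∧ le u₂ v₂ ∧ Orth u₁ u₂ ∧ add u₁ u₂ = u

/-- `nmul n a` is the iterated sum `n·a = a ⊕ ⋯ ⊕ a` (`n` times), with `0·a = 0`;
it is meaningful only when `nmulDef n a` holds. -/
def nmul : ℕ → E → E
  | 0, _ => zero
  | n + 1, a => add (nmul n a) a

/-- `nmulDef n a` says the iterated sum `n·a` is well defined. -/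
def nmulDef : ℕ → E → Prop
  | 0, _ => True
  | n + 1, a => nmulDef n a ∧ Orth (nmul n a) a

theorem orth_compl (a : E) : Orth a (compl a) :=
  (compl_exists a).exists.choose_spec.1

theorem add_compl (a : E) : add a (compl a) = one :=
  (compl_exists a).exists.choose_spec.2

theorem eq_compl {a b : E} (h : Orth a b) (h1 : add a b = one) : b = compl a :=
  (compl_exists a).unique ⟨h, h1⟩ ⟨orth_compl a, add_compl a⟩

theorem orth_symm {a b : E} (h : Orth a b) : Orth b a := orth_comm a b h

theorem assoc_right {a b c : E} (h : Orth a b) (h2 : Orth (add a b) c) :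
    Orth b c ∧ Orth a (add b c) ∧ add a (add b c) = add (add a b) c := by
  have hba := add_comm a b h
  obtain ⟨h3, h4, h5⟩ := assoc c b a (orth_symm h) (hba ▸ orth_symm h2)
  rw [add_comm c b h3] at h4 h5
  refine ⟨orth_symm h3, orth_symm h4, ?_⟩
  rw [add_comm a _ (orth_symm h4), ← h5, ← hba, add_comm _ _ h2]

theorem compl_one : compl (one : E) = zero :=
  orth_one _ (orth_symm (orth_compl one))

theorem zero_orth_one : Orth (zero : E) one :=
  orth_symm (compl_one (E := E) ▸ orth_compl one)

theorem zero_add_one : add (zero : E) one = one := by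
  rw [add_comm _ _ zero_orth_one]
  conv_lhs => rw [← compl_one]
  exact add_compl one

theorem zero_orth (a : E) : Orth zero a :=
  (assoc zero a (compl a) (orth_compl a) ((add_compl a).symm ▸ zero_orth_one)).1

theorem zero_add (a : E) : add zero a = a := by
  obtain ⟨-, h, h2⟩ :=
    assoc zero a (compl a) (orth_compl a) ((add_compl a).symm ▸ zero_orth_one)
  rw [add_compl, zero_add_one] at h2
  have h3 : add zero a = compl (compl a) :=
    eq_compl (orth_symm h) (by rw [add_comm _ _ (orth_symm h), ← h2])
  have h4 : a = compl (compl a) :=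
    eq_compl (orth_symm (orth_compl a))
      (by rw [add_comm _ _ (orth_symm (orth_compl a)), add_compl])
  exact h3.trans h4.symm

theorem add_zero (a : E) : add a zero = a := by
  rw [add_comm _ _ (orth_symm (zero_orth a)), zero_add]

theorem add_left_cancel {a b c : E} (hb : Orth a b) (hc : Orth a c)
    (h : add a b = add a c) : b = c := by
  obtain ⟨-, h3, h4⟩ := assoc (compl (add a b)) a b hb (orth_symm (orth_compl _))
  obtain ⟨-, h5, h6⟩ := assoc (compl (add a b)) a c hc (h ▸ orth_symm (orth_compl _))
  have e : add (compl (add a b)) (add a b) = one := by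
    rw [add_comm _ _ (orth_symm (orth_compl _)), add_compl]
  exact (eq_compl h3 (h4 ▸ e)).trans (eq_compl h5 (by rw [← h6, ← h]; exact e)).symm

theorem eq_zero_of_add_eq_zero {a b : E} (hab : Orth a b) (h : add a b = zero) :
    a = zero :=
  orth_one a (orth_symm (assoc one a b hab (h ▸ orth_symm zero_orth_one)).1)

theorem le_refl (a : E) : le a a := ⟨zero, orth_symm (zero_orth a), add_zero a⟩

theorem le_trans {a b c : E} (hab : le a b) (hbc : le b c) : le a c := by
  obtain ⟨x, hx, rfl⟩ := hab
  obtain ⟨y, hy, rfl⟩ := hbc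
  obtain ⟨-, h, h2⟩ := assoc_right hx hy
  exact ⟨_, h, h2⟩

theorem le_add_left {a b : E} (h : Orth a b) : le a (add a b) := ⟨b, h, rfl⟩

theorem le_add_right {a b : E} (h : Orth a b) : le b (add a b) :=
  ⟨a, orth_symm h, (add_comm a b h).symm⟩

theorem le_compl_iff {a b : E} : le a (compl b) ↔ Orth a b := by
  constructor
  · rintro ⟨d, hd, h⟩
    exact orth_symm (assoc b a d hd (h ▸ orth_compl b)).1
  · intro h
    obtain ⟨h1, h2, h3⟩ := assoc (compl (add a b)) a b h (orth_symm (orth_compl _))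
    rw [add_comm _ _ (orth_symm (orth_compl _)), add_compl] at h3
    rw [← eq_compl (orth_symm h2) (by rw [add_comm _ _ (orth_symm h2), ← h3])]
    exact le_add_right h1

theorem Orth.mono {a b c : E} (hbc : Orth b c) (hab : le a b) : Orth a c :=
  le_compl_iff.1 (le_trans hab (le_compl_iff.2 hbc))

theorem not_add_le {a x : E} (ha : a ≠ zero) (h : Orth x a) : ¬ le (add x a) x := by
  rintro ⟨c, hc, e⟩
  obtain ⟨h1, h2, h3⟩ := assoc_right h hc
  refine ha (eq_zero_of_add_eq_zero h1
    (add_left_cancel h2 (orth_symm (zero_orth x)) ?_))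
  rw [h3, e, add_zero]

theorem exists_not_nmulDef [Finite E] {a : E} (ha : a ≠ zero) :
    ∃ n : ℕ, ¬ nmulDef n a := by
  by_contra! h
  let : Preorder E :=
    { le := le
      le_refl := le_refl
      le_trans := fun _ _ _ => le_trans }
  have hmono : StrictMono fun n : ℕ => nmul n a :=
    strictMono_nat_of_lt_succ fun n =>
      lt_of_le_not_ge (le_add_left (h (n + 1)).2) (not_add_le ha (h (n + 1)).2)
  exact not_injective_infinite_finite _ hmono.injective

theorem Homogeneous.atom_le_of_le_nmul (hhom : Homogeneous E) {a : E} (ha : Atom a)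
    {n : ℕ} (hn : nmulDef n a) {c : E} (hc : c ≠ zero) (hle : le c (nmul n a))
    (horth : Orth (nmul n a) c) : le a c := by
  induction n generalizing c with
  | zero =>
    obtain ⟨d, hd, h⟩ := hle
    exact absurd (eq_zero_of_add_eq_zero hd h) hc
  | succ n ih =>
    obtain ⟨u₁, u₂, h₁, h₂, ho, rfl⟩ :=
      hhom c (nmul n a) a hn.2 hle (le_compl_iff.2 horth)
    by_cases hu : u₂ = zero
    · subst hu
      rw [add_zero] at *
      exact ih hn.1 hc h₁ (horth.mono (le_add_left hn.2))
    · rw [← ha.2 u₂ hu h₂]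
      exact le_add_right ho

theorem Homogeneous.sharp_nmul (hhom : Homogeneous E) {a : E} (ha : Atom a)
    {n : ℕ} (hn : nmulDef n a) (hmax : ¬ Orth (nmul n a) a) : Sharp (nmul n a) := by
  intro b hb hb'
  by_contra hb0
  have hbo := le_compl_iff.1 hb'
  exact hmax (orth_symm
    (hbo.mono (hhom.atom_le_of_le_nmul ha hn hb0 hb (orth_symm hbo))))

end EffectAlgebra

open EffectAlgebra

/-- Lemma 7 (lem32): in a finite homogeneous effect algebra with `S(E) = {0, 1}`,
for every atom `a` there is `n : ℕ` with `n·a` well defined and `a' = n·a`. -/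
theorem stmt6 {E : Type*} [EffectAlgebra E] [Finite E] (hhom : Homogeneous E)
    (hS : sharpSet E = {zero, one})
    (a : E) (ha : Atom a) :
    ∃ n : ℕ, nmulDef n a ∧ compl a = nmul n a := by
  classical
  have hex := exists_not_nmulDef (E := E) ha.1
  obtain ⟨m, hm⟩ : ∃ m, Nat.find hex = m + 2 := by
    refine ⟨Nat.find hex - 2, ?_⟩
    have : 1 < Nat.find hex := by
      rw [Nat.lt_find_iff]
      intro k hk
      interval_cases k
      · exact not_not.2 trivial
      · exact not_not.2 ⟨trivial, zero_orth a⟩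
    omega
  have hdef : nmulDef (m + 1) a := not_not.1 (Nat.find_min hex (by omega))
  have hmax : ¬ Orth (nmul (m + 1) a) a := fun h =>
    Nat.find_spec hex (hm ▸ ⟨hdef, h⟩)
  have hmem : nmul (m + 1) a ∈ sharpSet E := hhom.sharp_nmul ha hdef hmax
  rw [hS] at hmem
  rcases hmem with h | h
  · exact absurd (h ▸ zero_orth a) hmax
  · refine ⟨m, hdef.1, (eq_compl (orth_symm hdef.2) ?_).symm⟩
    rw [add_comm _ _ (orth_symm hdef.2)]
    exact h

end EffectAlgebraPaper
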